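/- arXiv:1104.2072 — 3 statements merged into one kernel-verified Lean document; each statement's English description precedes it below -/
import Mathlib

section
/- Assume X spans ℝ^n. Fix a linear order ≺ on X and for B ∈ 𝔹(X) define X(B) := {x ∈ X∖B : x ∉ span{b ∈ B : b ≺ x}}. Then the polynomials p_{X(B)}, B ∈ 𝔹(X), form a basis of the central space 𝒫(X). -/
open MvPolynomial

noncomputable section

/-- The linear polynomial `p_x : t ↦ x ⬝ t`. -/
def pLin (n : ℕ) (x : Fin n → ℝ) : MvPolynomial (Fin n) ℝ :=
  ∑ i, MvPolynomial.C (x i) * MvPolynomial.X i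

/-- `p_Z = ∏_{x ∈ Z} p_x` for a sub-multiset `Z` of the multiset indexed by `ι`. -/
def pProd (n : ℕ) {ι : Type} (v : ι → Fin n → ℝ) (Z : Finset ι) : MvPolynomial (Fin n) ℝ :=
  ∏ a ∈ Z, pLin n (v a)

/-- `q_Z = ∏_{x ∈ Z} (p_x - λ_x)`. -/
def qProd (n : ℕ) {ι : Type} (v : ι → Fin n → ℝ) (lam : ι → ℝ) (Z : Finset ι) :
    MvPolynomial (Fin n) ℝ :=
  ∏ a ∈ Z, (pLin n (v a) - MvPolynomial.C (lam a))

/-- The pairing `⟨p,q⟩ = (p(∂)q)(0) = ∑_α α! p_α q_α`. -/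
def pairing (n : ℕ) (p q : MvPolynomial (Fin n) ℝ) : ℝ :=
  ∑ α ∈ p.support, p.coeff α * q.coeff α * (α.prod fun _ e => (Nat.factorial e : ℝ))

/-- `B` is a basis of the multiset: its vectors form a basis of `ℝ^n`. -/
def IsBasisSet (n : ℕ) {ι : Type} (v : ι → Fin n → ℝ) (B : Finset ι) : Prop :=
  LinearIndependent ℝ (fun b : B => v b) ∧ Submodule.span ℝ (v '' ↑B) = ⊤

/-- The ideal `𝒥_{𝔹'}` generated by the `p_Z` over all `Z` meeting every `B ∈ 𝔹'`. -/
def Jideal (n : ℕ) {ι : Type} [DecidableEq ι] (v : ι → Fin n → ℝ) (𝔹' : Set (Finset ι)) :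
    Ideal (MvPolynomial (Fin n) ℝ) :=
  Ideal.span {p | ∃ Z : Finset ι, (∀ B ∈ 𝔹', (Z ∩ B).Nonempty) ∧ p = pProd n v Z}

/-- The kernel space `𝒟_{𝔹'}`. -/
def Dspace (n : ℕ) {ι : Type} [DecidableEq ι] (v : ι → Fin n → ℝ) (𝔹' : Set (Finset ι)) :
    Submodule ℝ (MvPolynomial (Fin n) ℝ) where
  carrier := {f | ∀ g ∈ Jideal n v 𝔹', pairing n g f = 0}
  zero_mem' := by intro g _; simp [pairing]
  add_mem' := by
    intro a b ha hb g hg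
    have h : pairing n g (a + b) = pairing n g a + pairing n g b := by
      simp only [pairing, MvPolynomial.coeff_add]
      rw [← Finset.sum_add_distrib]
      exact Finset.sum_congr rfl fun α _ => by ring
    rw [h, ha g hg, hb g hg, add_zero]
  smul_mem' := by
    intro c f hf g hg
    have h : pairing n g (c • f) = c * pairing n g f := by
      simp only [pairing, MvPolynomial.coeff_smul, smul_eq_mul, Finset.mul_sum]
      exact Finset.sum_congr rfl fun α _ => by ring
    rw [h, hf g hg, mul_zero]

/-- A solid assignment `k : 2^X → ℕ`. -/
def Solid (n : ℕ) {ι : Type} (v : ι → Fin n → ℝ) (k : Finset ι → ℕ) : Prop :=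
  ∀ Z Z' : Finset ι,
    Submodule.span ℝ (v '' ↑Z) ≤ Submodule.span ℝ (v '' ↑Z') → k Z ≤ k Z'

/-- An incremental assignment. -/
def Incremental {ι : Type} [DecidableEq ι] (k : Finset ι → ℕ) : Prop :=
  ∀ (Z : Finset ι) (x : ι), k (insert x Z) ≤ k Z + 1

/-- `m(I) = k(I) + n - #I`. -/
def mVal (n : ℕ) {ι : Type} (k : Finset ι → ℕ) (I : Finset ι) : ℕ := k I + n - I.card

/-- `B ∩ X` for `B ⊆ X ∪ Y`. -/
def leftPart {ι : Type} [Fintype ι] [DecidableEq ι] {M : ℕ} (B : Finset (ι ⊕ Fin M)) :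
    Finset ι :=
  Finset.univ.filter fun i => Sum.inl i ∈ B

/-- `B ∩ Y` for `B ⊆ X ∪ Y`, as a set of indices in `Y`. -/
def rightPart {ι : Type} [Fintype ι] [DecidableEq ι] {M : ℕ} (B : Finset (ι ⊕ Fin M)) :
    Finset (Fin M) :=
  Finset.univ.filter fun j => Sum.inr j ∈ B

/-- `Y_i = {y_1, …, y_i}` as a set of indices. -/
def YFin {M : ℕ} (i : ℕ) : Finset (Fin M) := Finset.univ.filter fun j => (j : ℕ) < i

/-- `X ∪ Y_i` as a subset of the index set of `X ∪ Y`. -/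
def XYup (ι : Type) [Fintype ι] [DecidableEq ι] (M : ℕ) (i : ℕ) : Finset (ι ⊕ Fin M) :=
  Finset.univ.image Sum.inl ∪ (YFin (M := M) i).image Sum.inr

/-- `Y` is in general position in `X ∪ Y`: no `y ∈ Y` lies in the span of fewer than `n`
vectors of `(X ∪ Y) ∖ {y}`. -/
def GeneralPosition (n : ℕ) {ι : Type} [Fintype ι] [DecidableEq ι] {M : ℕ}
    (v : ι → Fin n → ℝ) (y : Fin M → Fin n → ℝ) : Prop :=
  ∀ (j : Fin M) (S : Finset (ι ⊕ Fin M)), Sum.inr j ∉ S → S.card < n →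
    y j ∉ Submodule.span ℝ (Sum.elim v y '' ↑S)

/-- `𝔹_k : the bases `B` of `X ∪ Y` with `B ∩ Y ⊆ Y_{m(B ∩ X)}`. -/
def Bk (n : ℕ) {ι : Type} [Fintype ι] [DecidableEq ι] (v : ι → Fin n → ℝ) {M : ℕ}
    (y : Fin M → Fin n → ℝ) (k : Finset ι → ℕ) : Set (Finset (ι ⊕ Fin M)) :=
  {B | IsBasisSet n (Sum.elim v y) B ∧
    ∀ j : Fin M, Sum.inr j ∈ B → (j : ℕ) < mVal n k (leftPart B)}

/-- The space `𝒫_k = ∑_{Z ⊆ X} p_{X∖Z} Π_{k(Z)}`. -/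
def Pspace (n : ℕ) {ι : Type} [Fintype ι] [DecidableEq ι] (v : ι → Fin n → ℝ)
    (k : Finset ι → ℕ) : Submodule ℝ (MvPolynomial (Fin n) ℝ) :=
  ⨆ Z : Finset ι,
    Submodule.map (LinearMap.mulLeft ℝ (pProd n v (Finset.univ \ Z)))
      (MvPolynomial.restrictTotalDegree (Fin n) ℝ (k Z))

/-- The constants `λ` are generic: each basis `B` determines a point `bp B` at which
`q_z` vanishes exactly when `z ∈ B`. -/
def Generic (n : ℕ) {ι : Type} (v : ι → Fin n → ℝ) (lam : ι → ℝ)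
    (bp : Finset ι → Fin n → ℝ) : Prop :=
  ∀ B : Finset ι, IsBasisSet n v B →
    ∀ z : ι, MvPolynomial.eval (bp B) (pLin n (v z) - MvPolynomial.C (lam z)) = 0 ↔ z ∈ B

/-- `x` is placable in `𝔹'`. -/
def Placable {ι : Type} [DecidableEq ι] (x : ι) (𝔹' : Set (Finset ι)) : Prop :=
  ∀ B ∈ 𝔹', ∃ a ∈ B, (insert x B).erase a ∈ 𝔹'

/-- `𝔹'` is placible. -/
inductive Placible {ι : Type} [DecidableEq ι] : Set (Finset ι) → Prop
  | singleton (B : Finset ι) : Placible {B}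
  | split (𝔹' : Set (Finset ι)) (x : ι) (hx : Placable x 𝔹')
      (hne1 : {B ∈ 𝔹' | x ∈ B}.Nonempty) (hne2 : {B ∈ 𝔹' | x ∉ B}.Nonempty)
      (hp1 : Placible {B ∈ 𝔹' | x ∈ B}) (hp2 : Placible {B ∈ 𝔹' | x ∉ B}) :
      Placible 𝔹'

/-- `X(I)` : the elements of `X ∖ I` not in the span of the earlier elements of `I`. -/
def XsetI (n : ℕ) {ι : Type} [Fintype ι] [DecidableEq ι] [LinearOrder ι]
    (v : ι → Fin n → ℝ) (I : Finset ι) : Finset ι := by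
  classical
  exact Finset.univ.filter fun x =>
    x ∉ I ∧ v x ∉ Submodule.span ℝ (v '' {b | b ∈ I ∧ b < x})

/-- `X'(B)` for `B ⊆ X ∪ Y`, with the order on `X ∪ Y` putting `X` (with its own order)
before `Y` (ordered as given). -/
def XprimeB (n : ℕ) {ι : Type} [Fintype ι] [DecidableEq ι] [LinearOrder ι] {M : ℕ}
    (v : ι → Fin n → ℝ) (y : Fin M → Fin n → ℝ) (B : Finset (ι ⊕ Fin M)) :
    Finset (ι ⊕ Fin M) := by
  classical
  exact Finset.univ.filter fun z =>
    z ∉ B ∧ Sum.elim v y z ∉ Submodule.span ℝ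
      (Sum.elim v y '' {b | b ∈ B ∧ Sum.Lex (· < ·) (· < ·) b z})

/-- The least space `Π(Θ)`. -/
def leastSpace (n : ℕ) (Θ : Finset (Fin n → ℝ)) : Submodule ℝ (MvPolynomial (Fin n) ℝ) :=
  Submodule.span ℝ
    {f | ∃ (c : (Fin n → ℝ) → ℝ) (J : ℕ),
      f = (Nat.factorial J : ℝ)⁻¹ • ∑ θ ∈ Θ, c θ • pLin n θ ^ J ∧ f ≠ 0 ∧
      ∀ j < J, ∑ θ ∈ Θ, c θ • pLin n θ ^ j = 0}

/-- The central space `𝒫(X)`, spanned by the `p_Z` over short `Z`. -/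
def centralP (n : ℕ) {ι : Type} [Fintype ι] [DecidableEq ι] (v : ι → Fin n → ℝ) :
    Submodule ℝ (MvPolynomial (Fin n) ℝ) :=
  Submodule.span ℝ
    {p | ∃ Z : Finset ι, Submodule.span ℝ (v '' ↑(Finset.univ \ Z)) = ⊤ ∧ p = pProd n v Z}

end

theorem eval_pProd' (n : ℕ) {ι : Type} (v : ι → Fin n → ℝ) (Z : Finset ι) (t : Fin n → ℝ) :
    MvPolynomial.eval t (pProd n v Z) = ∏ a ∈ Z, (v a ⬝ᵥ t) := by
  simp [pProd, pLin, dotProduct, map_prod]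

theorem mem_XsetI' (n : ℕ) {ι : Type} [Fintype ι] [DecidableEq ι] [LinearOrder ι]
    (v : ι → Fin n → ℝ) (I : Finset ι) (x : ι) :
    x ∈ XsetI n v I ↔ x ∉ I ∧ v x ∉ Submodule.span ℝ (v '' {b | b ∈ I ∧ b < x}) := by
  simp [XsetI]

theorem exists_dot {n : ℕ} (W : Submodule ℝ (Fin n → ℝ)) (x : Fin n → ℝ) (hx : x ∉ W) :
    ∃ u : Fin n → ℝ, (∀ w ∈ W, w ⬝ᵥ u = 0) ∧ x ⬝ᵥ u ≠ 0 := by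
  obtain ⟨f, hf, hW⟩ := Submodule.exists_le_ker_of_notMem hx
  have key : ∀ w : Fin n → ℝ, w ⬝ᵥ (fun i => f (Pi.single i 1)) = f w := by
    intro w
    conv_rhs => rw [pi_eq_sum_univ' w]
    simp only [map_sum, map_smul, dotProduct, smul_eq_mul]
  refine ⟨fun i => f (Pi.single i 1), ?_, ?_⟩
  · intro w hw
    rw [key]; exact hW hw
  · rw [key]; exact hf

theorem indep_aux (n : ℕ) {ι : Type} [Fintype ι] [DecidableEq ι] [LinearOrder ι]
    (v : ι → Fin n → ℝ) (N : ℕ) : ∀ (T I : Finset ι), T.card = N →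
    (∀ a ∈ T, ∀ b, b ∉ T → b < a) → ∀ c : Finset ι → ℝ,
    (∀ B, c B ≠ 0 → IsBasisSet n v B ∧ B \ T = I) →
    (∀ t : Fin n → ℝ, (∀ i ∈ I, v i ⬝ᵥ t = 0) →
      ∑ B, c B * ∏ a ∈ XsetI n v B ∩ T, (v a ⬝ᵥ t) = 0) → ∀ B, c B = 0 := by
  induction N with
  | zero =>
    intro T I hT _ c hc h B
    rw [Finset.card_eq_zero] at hT
    subst hT
    by_contra hB
    have h0 := h 0 (by simp)
    rw [Finset.sum_eq_single B] at h0
    · simp at h0; exact hB h0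
    · intro B' _ hne
      by_contra h1
      have : c B' ≠ 0 := fun h2 => h1 (by simp [h2])
      have e1 := (hc B' this).2
      have e2 := (hc B hB).2
      simp at e1 e2
      exact hne (e1.trans e2.symm)
    · simp
  | succ N ih =>
    intro T I hT hup c hc h
    have hne : T.Nonempty := by rw [← Finset.card_pos]; omega
    obtain ⟨x, hxT, hmin⟩ : ∃ x ∈ T, ∀ y ∈ T, x ≤ y :=
      ⟨T.min' hne, T.min'_mem hne, fun y hy => T.min'_le y hy⟩
    have hcard : (T.erase x).card = N := by rw [Finset.card_erase_of_mem hxT]; omega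
    have hup' : ∀ a ∈ T.erase x, ∀ b, b ∉ T.erase x → b < a := by
      intro a ha b hb
      rw [Finset.mem_erase] at ha hb
      by_cases hbx : b = x
      · subst hbx; exact lt_of_le_of_ne (hmin a ha.2) (Ne.symm ha.1)
      · exact hup a ha.2 b (fun hbT => hb ⟨hbx, hbT⟩)
    have hlow : ∀ B, B \ T = I → {b | b ∈ B ∧ b < x} = (I : Set ι) := by
      intro B hB
      ext b
      rw [← hB]
      simp only [Set.mem_ofPred_eq, Finset.coe_sdiff, Set.mem_sdiff, Finset.mem_coe]
      refine and_congr_right fun _ => ⟨fun hb hbT => absurd (hmin b hbT) (not_le.2 hb),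
        fun hb => hup x hxT b hb⟩
    have hXm : ∀ B, B \ T = I → (x ∈ XsetI n v B ↔ x ∉ B ∧ v x ∉ Submodule.span ℝ (v '' I)) := by
      intro B hB
      rw [mem_XsetI', hlow B hB]
    have hprod1 : ∀ B t, x ∉ XsetI n v B → ∏ a ∈ XsetI n v B ∩ T, (v a ⬝ᵥ t) =
        ∏ a ∈ XsetI n v B ∩ T.erase x, (v a ⬝ᵥ t) := by
      intro B t hx
      congr 1
      ext a
      simp only [Finset.mem_inter, Finset.mem_erase]
      constructor
      · rintro ⟨h1, h2⟩
        exact ⟨h1, fun e => hx (e ▸ h1), h2⟩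
      · rintro ⟨h1, _, h2⟩; exact ⟨h1, h2⟩
    have hprod2 : ∀ B t, x ∈ XsetI n v B → ∏ a ∈ XsetI n v B ∩ T, (v a ⬝ᵥ t) =
        (v x ⬝ᵥ t) * ∏ a ∈ XsetI n v B ∩ T.erase x, (v a ⬝ᵥ t) := by
      intro B t hx
      rw [← Finset.mul_prod_erase _ _ (Finset.mem_inter.2 ⟨hx, hxT⟩)]
      congr 2
      ext a
      simp only [Finset.mem_inter, Finset.mem_erase]
      tauto
    have hsd1 : ∀ B, B \ T = I → x ∉ B → B \ T.erase x = I := by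
      intro B hB hx
      rw [← hB]
      ext a
      simp only [Finset.mem_sdiff, Finset.mem_erase]
      constructor
      · rintro ⟨h1, h2⟩
        exact ⟨h1, fun h3 => h2 ⟨fun e => hx (e ▸ h1), h3⟩⟩
      · rintro ⟨h1, h2⟩; exact ⟨h1, fun h3 => h2 h3.2⟩
    have hsd2 : ∀ B, B \ T = I → x ∈ B → B \ T.erase x = insert x I := by
      intro B hB hx
      rw [← hB]
      ext a
      simp only [Finset.mem_sdiff, Finset.mem_erase, Finset.mem_insert]
      by_cases hax : a = x
      · subst hax; simp [hx]
      · simp [hax]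
    by_cases hxI : v x ∈ Submodule.span ℝ (v '' I)
    · have hxB : ∀ B, c B ≠ 0 → x ∉ B := by
        intro B hB hx
        obtain ⟨⟨hli, _⟩, hBT⟩ := hc B hB
        have hli' : LinearIndepOn ℝ v (B : Set ι) := hli
        have hins : insert x ((B : Set ι) \ {x}) = B := by
          rw [Set.insert_sdiff_singleton, Set.insert_eq_of_mem (by exact_mod_cast hx)]
        rw [← hins] at hli'
        refine hli'.notMem_span_of_insert (by simp) (Submodule.span_mono (Set.image_mono ?_) hxI)
        rw [← hlow B hBT]
        rintro b ⟨h1, h2⟩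
        exact ⟨h1, h2.ne⟩
      refine ih (T.erase x) I hcard hup' c (fun B hB => ⟨(hc B hB).1, hsd1 B (hc B hB).2 (hxB B hB)⟩) ?_
      intro t ht
      refine Eq.trans ?_ (h t ht)
      refine Finset.sum_congr rfl fun B _ => ?_
      by_cases hB : c B = 0
      · simp [hB]
      · rw [hprod1 B t]
        rw [hXm B (hc B hB).2]; tauto
    · have hA : ∀ B, (if x ∈ B then c B else 0) = 0 := by
        refine ih (T.erase x) (insert x I) hcard hup' (fun B => if x ∈ B then c B else 0) ?_ ?_
        · intro B hB
          by_cases hx : x ∈ B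
          · simp only [hx, if_true] at hB
            exact ⟨(hc B hB).1, hsd2 B (hc B hB).2 hx⟩
          · simp [hx] at hB
        · intro t ht
          refine Eq.trans ?_ (h t (fun i hi => ht i (Finset.mem_insert_of_mem hi)))
          refine Finset.sum_congr rfl fun B _ => ?_
          by_cases hB : c B = 0
          · simp [hB]
          by_cases hx : x ∈ B
          · rw [hprod1 B t]
            · simp [hx]
            · rw [hXm B (hc B hB).2]; tauto
          · rw [hprod2 B t]
            · simp [hx, ht x (Finset.mem_insert_self _ _)]
            · rw [hXm B (hc B hB).2]; tauto
      have hxB : ∀ B, c B ≠ 0 → x ∉ B := by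
        intro B hB hx
        have := hA B
        simp [hx] at this
        exact hB this
      refine ih (T.erase x) I hcard hup' c (fun B hB => ⟨(hc B hB).1, hsd1 B (hc B hB).2 (hxB B hB)⟩) ?_
      have hmul : ∀ t : Fin n → ℝ, (∀ i ∈ I, v i ⬝ᵥ t = 0) →
          (v x ⬝ᵥ t) * ∑ B, c B * ∏ a ∈ XsetI n v B ∩ T.erase x, (v a ⬝ᵥ t) = 0 := by
        intro t ht
        refine Eq.trans ?_ (h t ht)
        rw [Finset.mul_sum]
        refine Finset.sum_congr rfl fun B _ => ?_
        by_cases hB : c B = 0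
        · simp [hB]
        · rw [hprod2 B t]
          · ring
          · rw [hXm B (hc B hB).2]; exact ⟨hxB B hB, hxI⟩
      intro t ht
      obtain ⟨u, hu, hxu⟩ := exists_dot _ _ hxI
      by_cases hxt : v x ⬝ᵥ t = 0
      · let f : ℝ → ℝ := fun s =>
          ∑ B, c B * ∏ a ∈ XsetI n v B ∩ T.erase x, (v a ⬝ᵥ (t + s • u))
        have hf : Continuous f := by
          simp only [f, dotProduct_add, dotProduct_smul]
          fun_prop
        have hz : ∀ s, s ≠ 0 → f s = 0 := by
          intro s hs
          have := hmul (t + s • u) (fun i hi => by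
            rw [dotProduct_add, dotProduct_smul, ht i hi,
              hu _ (Submodule.subset_span ⟨i, hi, rfl⟩)]; simp)
          rcases mul_eq_zero.1 this with h1 | h1
          · rw [dotProduct_add, dotProduct_smul, hxt, zero_add, smul_eq_mul] at h1
            rcases mul_eq_zero.1 h1 with h2 | h2
            · exact absurd h2 hs
            · exact absurd h2 hxu
          · exact h1
        have : f = fun _ => 0 :=
          hf.ext_on (dense_compl_singleton (0 : ℝ)) continuous_const (fun s hs => hz s hs)
        have h0 := congrFun this 0
        simpa [f] using h0
      · exact (mul_eq_zero.1 (hmul t ht)).resolve_left hxt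

theorem greedy_indep (n : ℕ) {ι : Type} [DecidableEq ι] [LinearOrder ι]
    (v : ι → Fin n → ℝ) (B : Finset ι) :
    (∀ b ∈ B, v b ∉ Submodule.span ℝ (v '' {a | a ∈ B ∧ a < b})) →
    LinearIndepOn ℝ v (B : Set ι) := by
  induction B using Finset.induction_on_max with
  | empty => intro _; simp
  | insert a s hs ih =>
    intro h
    have has : a ∉ s := fun h => lt_irrefl _ (hs a h)
    rw [Finset.coe_insert, linearIndepOn_insert (by simpa using has)]
    constructor
    · apply ih
      intro b hb hm
      refine h b (Finset.mem_insert_of_mem hb) (Submodule.span_mono (Set.image_mono ?_) hm)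
      rintro c ⟨h1, h2⟩
      exact ⟨Finset.mem_insert_of_mem h1, h2⟩
    · intro hm
      refine h a (Finset.mem_insert_self _ _) (Submodule.span_mono (Set.image_mono ?_) hm)
      intro c hc
      exact ⟨Finset.mem_insert_of_mem hc, hs c hc⟩

theorem exists_greedy (n : ℕ) {ι : Type} [Fintype ι] [DecidableEq ι] [LinearOrder ι]
    (v : ι → Fin n → ℝ) (W : Finset ι) (hW : Submodule.span ℝ (v '' ↑W) = ⊤) :
    ∃ B ⊆ W, IsBasisSet n v B ∧
      ∀ w ∈ W, w ∉ B → v w ∈ Submodule.span ℝ (v '' {b | b ∈ B ∧ b < w}) := by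
  classical
  let B := W.filter fun w => v w ∉ Submodule.span ℝ (v '' {u | u ∈ W ∧ u < w})
  have hBW : B ⊆ W := Finset.filter_subset _ _
  have key : ∀ w, w ∈ W → v w ∈ Submodule.span ℝ (v '' {b | b ∈ B ∧ b ≤ w}) ∧
      (w ∉ B → v w ∈ Submodule.span ℝ (v '' {b | b ∈ B ∧ b < w})) := by
    intro w
    induction w using WellFoundedLT.induction with
    | ind w ih =>
      intro hw
      have h2 : w ∉ B → v w ∈ Submodule.span ℝ (v '' {b | b ∈ B ∧ b < w}) := by
        intro hwB
        have h3 : v w ∈ Submodule.span ℝ (v '' {u | u ∈ W ∧ u < w}) := by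
          by_contra h
          exact hwB (Finset.mem_filter.2 ⟨hw, h⟩)
        refine (Submodule.span_le.2 ?_) h3
        rintro _ ⟨u, ⟨huW, hu⟩, rfl⟩
        refine Submodule.span_mono (Set.image_mono ?_) (ih u hu huW).1
        rintro b ⟨h1, h2⟩
        exact ⟨h1, lt_of_le_of_lt h2 hu⟩
      refine ⟨?_, h2⟩
      by_cases hwB : w ∈ B
      · exact Submodule.subset_span ⟨w, ⟨hwB, le_rfl⟩, rfl⟩
      · refine Submodule.span_mono (Set.image_mono ?_) (h2 hwB)
        rintro b ⟨h1, h2⟩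
        exact ⟨h1, h2.le⟩
  refine ⟨B, hBW, ⟨?_, ?_⟩, fun w hw => (key w hw).2⟩
  · refine greedy_indep n v B ?_
    intro b hb hm
    refine (Finset.mem_filter.1 hb).2 (Submodule.span_mono (Set.image_mono ?_) hm)
    rintro c ⟨h1, h2⟩
    exact ⟨hBW h1, h2⟩
  · rw [eq_top_iff, ← hW, Submodule.span_le]
    rintro _ ⟨w, hw, rfl⟩
    refine Submodule.span_mono (Set.image_mono ?_) (key w hw).1
    rintro b ⟨h1, _⟩
    exact h1

theorem pLin_sum (n : ℕ) {ι : Type} (v : ι → Fin n → ℝ) (s : Finset ι) (c : ι → ℝ) :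
    pLin n (∑ b ∈ s, c b • v b) = ∑ b ∈ s, c b • pLin n (v b) := by
  simp only [pLin, Finset.sum_apply, Pi.smul_apply, smul_eq_mul, map_sum, map_mul,
    Finset.sum_mul, Finset.smul_sum, MvPolynomial.smul_eq_C_mul]
  rw [Finset.sum_comm]
  simp only [mul_assoc]

theorem span_aux (n : ℕ) {ι : Type} [Fintype ι] [DecidableEq ι] [LinearOrder ι]
    (v : ι → Fin n → ℝ) (N : ℕ) : ∀ Z : Finset ι,
    (∑ z ∈ Z, (Finset.univ.filter (· < z)).card) = N →
    Submodule.span ℝ (v '' ↑(Finset.univ \ Z)) = ⊤ →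
    pProd n v Z ∈ Submodule.span ℝ (Set.range fun B : {B : Finset ι // IsBasisSet n v B} =>
      pProd n v (XsetI n v (B : Finset ι))) := by
  induction N using Nat.strong_induction_on with
  | _ N ih =>
  intro Z hN hZ
  obtain ⟨B, hBW, hB, hg⟩ := exists_greedy n v _ hZ
  have hsub : XsetI n v B ⊆ Z := by
    intro y hy
    rw [mem_XsetI'] at hy
    by_contra hyZ
    exact hy.2 (hg y (by simp [hyZ]) hy.1)
  by_cases hEq : Z ⊆ XsetI n v B
  · rw [Finset.Subset.antisymm hEq hsub]
    exact Submodule.subset_span ⟨⟨B, hB⟩, rfl⟩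
  obtain ⟨z, hzZ, hzX⟩ := Finset.not_subset.1 hEq
  have hBZ : ∀ b ∈ B, b ∉ Z := fun b hb => by simpa using hBW hb
  have hzB : z ∉ B := fun h => hBZ z h hzZ
  have hzs : v z ∈ Submodule.span ℝ (v '' ↑(B.filter (· < z))) := by
    rw [mem_XsetI'] at hzX
    have : v z ∈ Submodule.span ℝ (v '' {b | b ∈ B ∧ b < z}) := by tauto
    simpa using this
  rw [Submodule.mem_span_image_finset_iff_exists_fun] at hzs
  obtain ⟨c', hc'⟩ := hzs
  obtain ⟨c, hc⟩ : ∃ c : ι → ℝ, ∑ b ∈ B.filter (· < z), c b • v b = v z := by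
    refine ⟨fun b => if h : b ∈ B.filter (· < z) then c' ⟨b, h⟩ else 0, ?_⟩
    rw [← hc', ← Finset.sum_coe_sort]
    refine Finset.sum_congr rfl fun b _ => ?_
    beta_reduce
    rw [dif_pos b.2]
  have hp : pProd n v Z =
      ∑ b ∈ B.filter (· < z), c b • pProd n v (insert b (Z.erase z)) := by
    have h1 : pProd n v Z = pLin n (v z) * pProd n v (Z.erase z) :=
      (Finset.mul_prod_erase _ _ hzZ).symm
    rw [h1, ← hc, pLin_sum, Finset.sum_mul]
    refine Finset.sum_congr rfl fun b hb => ?_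
    have hbZ : b ∉ Z.erase z := fun h =>
      hBZ b (Finset.mem_filter.1 hb).1 (Finset.mem_of_mem_erase h)
    rw [pProd, pProd, Finset.prod_insert hbZ, smul_mul_assoc]
  rw [hp]
  refine Submodule.sum_mem _ fun b hb => ?_
  by_cases hcb : c b = 0
  · simp [hcb]
  refine Submodule.smul_mem _ _ (ih _ ?_ (insert b (Z.erase z)) rfl ?_)
  · obtain ⟨hbB, hbz⟩ := Finset.mem_filter.1 hb
    have hbZ : b ∉ Z.erase z := fun h => hBZ b hbB (Finset.mem_of_mem_erase h)
    rw [Finset.sum_insert hbZ, ← hN, ← Finset.add_sum_erase _ _ hzZ]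
    refine Nat.add_lt_add_right (Finset.card_lt_card ?_) _
    rw [Finset.ssubset_iff_of_subset]
    · exact ⟨b, by simpa using hbz, by simp⟩
    · intro a ha
      simp only [Finset.mem_filter, Finset.mem_univ, true_and] at ha ⊢
      exact ha.trans hbz
  · obtain ⟨hbB, hbz⟩ := Finset.mem_filter.1 hb
    set S := Submodule.span ℝ (v '' ↑(Finset.univ \ insert b (Z.erase z))) with hS
    have hmem : ∀ a ∈ B, a ≠ b → v a ∈ S := by
      intro a ha hab
      refine Submodule.subset_span ⟨a, ?_, rfl⟩
      simp [hab, hBZ a ha]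
    have hzS : v z ∈ S := by
      refine Submodule.subset_span ⟨z, ?_, rfl⟩
      simp [hbz.ne']
    have hbS : v b ∈ S := by
      rw [← Finset.add_sum_erase _ _ hb] at hc
      have h2 : c b • v b ∈ S := by
        rw [eq_sub_of_add_eq hc]
        refine Submodule.sub_mem _ hzS (Submodule.sum_mem _ fun a ha => ?_)
        rw [Finset.mem_erase, Finset.mem_filter] at ha
        exact Submodule.smul_mem _ _ (hmem a ha.2.1 ha.1)
      exact (Submodule.smul_mem_iff _ hcb).1 h2
    rw [eq_top_iff, ← hB.2, Submodule.span_le]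
    rintro _ ⟨a, ha, rfl⟩
    by_cases hab : a = b
    · rw [hab]; exact hbS
    · exact hmem a ha hab

/-- if `X` spans `ℝ^n`, the polynomials `p_{X(B)}`, `B ∈ 𝔹(X)`, form a
basis of the central space `𝒫(X)`. -/
theorem statement17
    (n : ℕ) (hn : 1 ≤ n) (ι : Type) [Fintype ι] [DecidableEq ι] [LinearOrder ι]
    (v : ι → Fin n → ℝ)
    (hspan : Submodule.span ℝ (Set.range v) = ⊤) :
    LinearIndependent ℝ (fun B : {B : Finset ι // IsBasisSet n v B} =>
      pProd n v (XsetI n v (B : Finset ι))) ∧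
    Submodule.span ℝ (Set.range fun B : {B : Finset ι // IsBasisSet n v B} =>
      pProd n v (XsetI n v (B : Finset ι))) = centralP n v := by
  classical
  constructor
  · rw [Fintype.linearIndependent_iff]
    intro g hg
    let c : Finset ι → ℝ := fun B => if h : IsBasisSet n v B then g ⟨B, h⟩ else 0
    have hc := indep_aux n v _ Finset.univ ∅ rfl (by simp) c (by
      intro B hB
      refine ⟨?_, by simp⟩
      by_contra h
      exact hB (by simp [c, h])) (by
      intro t _
      have h1 := congrArg (MvPolynomial.eval t) hg
      simp only [map_sum, MvPolynomial.smul_eval, eval_pProd', map_zero] at h1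
      simp only [Finset.inter_univ]
      refine Eq.trans ?_ h1
      rw [← Finset.sum_subset (Finset.subset_univ (Finset.univ.filter (IsBasisSet n v)))
        (by intro B _ hB; simp only [Finset.mem_filter, Finset.mem_univ, true_and] at hB; simp [c, hB]),
        Finset.sum_subtype (p := IsBasisSet n v) _ (by simp)]
      refine Finset.sum_congr rfl fun B _ => ?_
      simp [c, B.2])
    intro B
    have := hc B.1
    simpa [c, B.2] using this
  · apply le_antisymm
    · rw [Submodule.span_le]
      rintro _ ⟨B, rfl⟩
      refine Submodule.subset_span ⟨_, ?_, rfl⟩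
      rw [eq_top_iff, ← B.2.2]
      refine Submodule.span_mono (Set.image_mono ?_)
      intro b hb
      have hb' : b ∈ B.1 := hb
      simp [mem_XsetI', hb']
    · rw [centralP, Submodule.span_le]
      rintro _ ⟨Z, hZ, rfl⟩
      exact span_aux n v _ Z rfl hZ
end

section
/- Assume X spans ℝ^n and the constants (λ_x)_{x∈X} are generic. Then the polynomials q_{X∖B}, B ∈ 𝔹(X), form a Lagrange basis for 𝒫(X) with respect to the vertex set b(𝔹(X)): each q_{X∖B} belongs to 𝒫(X), satisfies q_{X∖B}(b(B)) ≠ 0 and q_{X∖B}(b(B′)) = 0 for every B′ ∈ 𝔹(X) with B′ ≠ B, and together these polynomials form a basis of 𝒫(X). -/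
open MvPolynomial

lemma aux_expand (n : ℕ) {ι : Type} [DecidableEq ι] (v : ι → Fin n → ℝ) (f g : ι → MvPolynomial (Fin n) ℝ)
    (l : ι → ℝ) (h : ∀ a, f a = g a + C (l a)) (S : Submodule ℝ (MvPolynomial (Fin n) ℝ))
    (Z : Finset ι) (hS : ∀ Z' ⊆ Z, ∏ a ∈ Z', g a ∈ S) : ∏ a ∈ Z, f a ∈ S := by
  rw [Finset.prod_congr rfl (fun a _ => h a), Finset.prod_add]
  refine Submodule.sum_mem _ fun t ht => ?_
  rw [← map_prod, mul_comm, ← MvPolynomial.smul_eq_C_mul]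
  exact S.smul_mem _ (hS t (Finset.mem_powerset.1 ht))

lemma aux_short (n : ℕ) {ι : Type} [Fintype ι] [DecidableEq ι] (v : ι → Fin n → ℝ)
    {Z Z' : Finset ι} (h : Z' ⊆ Z) (hZ : Submodule.span ℝ (v '' ↑(Finset.univ \ Z)) = ⊤) :
    Submodule.span ℝ (v '' ↑(Finset.univ \ Z')) = ⊤ := by
  refine top_le_iff.1 (hZ ▸ Submodule.span_mono (Set.image_mono ?_))
  exact Finset.coe_subset.2 (Finset.sdiff_subset_sdiff le_rfl h)

lemma aux_key (n : ℕ) {ι : Type} [Fintype ι] [DecidableEq ι]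
    (v : ι → Fin n → ℝ) (lam : ι → ℝ) (bp : Finset ι → Fin n → ℝ)
    (hgeneric : Generic n v lam bp) (S : Submodule ℝ (MvPolynomial (Fin n) ℝ))
    (hS : ∀ B, IsBasisSet n v B → qProd n v lam (Finset.univ \ B) ∈ S) (W : Finset ι) :
    Submodule.span ℝ (v '' ↑W) = ⊤ → qProd n v lam (Finset.univ \ W) ∈ S := by
  induction W using Finset.strongInduction with
  | H W ih =>
  intro hW
  obtain ⟨b, hbW, -, hspan, hli⟩ := exists_linearIndepOn_extension (K := ℝ) (v := v)
    (linearIndepOn_empty ℝ v) (Set.empty_subset (W : Set ι))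
  obtain ⟨B, rfl⟩ : ∃ B : Finset ι, (B : Set ι) = b := ⟨b.toFinite.toFinset, by simp⟩
  have hBspan : Submodule.span ℝ (v '' ↑B) = ⊤ := by
    rw [← top_le_iff, ← hW]; exact Submodule.span_le.2 hspan
  have hB : IsBasisSet n v B := ⟨hli, hBspan⟩
  have hBW : B ⊆ W := Finset.coe_subset.1 hbW
  by_cases hEq : B = W
  · exact hEq ▸ hS B hB
  obtain ⟨w, hwW, hwB⟩ := Finset.exists_of_ssubset (lt_of_le_of_ne hBW hEq)
  have hmem : v w ∈ Submodule.span ℝ (v '' ↑B) := by rw [hBspan]; trivial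
  obtain ⟨c', hc'⟩ := (Submodule.mem_span_image_finset_iff_exists_fun ℝ).1 hmem
  obtain ⟨c, hc⟩ : ∃ c : ι → ℝ, ∑ i ∈ B, c i • v i = v w := by
    refine ⟨fun i => if h : i ∈ B then c' ⟨i, h⟩ else 0, ?_⟩
    rw [← hc', ← Finset.sum_coe_sort]
    exact Finset.sum_congr rfl fun i _ => by simp
  have hlin : pLin n (v w) = ∑ b ∈ B, C (c b) * pLin n (v b) := by
    rw [← hc]
    simp only [pLin, Finset.mul_sum, Finset.sum_apply, Pi.smul_apply, smul_eq_mul, map_sum, map_mul,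
      Finset.sum_mul]
    rw [Finset.sum_comm]
    simp only [mul_assoc]
  set k : ℝ := ∑ b ∈ B, c b * lam b - lam w with hk
  have hid : (pLin n (v w) - C (lam w)) - ∑ b ∈ B, C (c b) * (pLin n (v b) - C (lam b)) = C k := by
    simp only [mul_sub, Finset.sum_sub_distrib, ← hlin, hk, map_sub, map_sum, map_mul]
    ring
  have hk0 : k ≠ 0 := by
    intro h0
    apply hwB
    rw [← hgeneric B hB w]
    have := congrArg (MvPolynomial.eval (bp B)) hid
    rw [map_sub, map_sum, eval_C, h0, Finset.sum_eq_zero, sub_zero] at this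
    · exact this
    · intro b hb
      rw [map_mul, (hgeneric B hB b).2 hb, mul_zero]
  have hins : ∀ x ∈ W, (pLin n (v x) - C (lam x)) * qProd n v lam (Finset.univ \ W)
      = qProd n v lam (Finset.univ \ W.erase x) := by
    intro x hx
    have : Finset.univ \ W.erase x = insert x (Finset.univ \ W) := by
      ext y; by_cases hy : y = x <;> simp [hy]
    rw [this, qProd, qProd, Finset.prod_insert (by simp [hx])]
  have hfin : k • qProd n v lam (Finset.univ \ W) = qProd n v lam (Finset.univ \ W.erase w)
      - ∑ b ∈ B, c b • qProd n v lam (Finset.univ \ W.erase b) := by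
    rw [MvPolynomial.smul_eq_C_mul, ← hid, sub_mul, hins w hwW, Finset.sum_mul]
    congr 1
    refine Finset.sum_congr rfl fun b hb => ?_
    rw [mul_assoc, hins b (hBW hb), MvPolynomial.smul_eq_C_mul]
  rw [← S.smul_mem_iff hk0, hfin]
  refine S.sub_mem (ih _ (Finset.erase_ssubset hwW) ?_) (S.sum_mem fun b hb => ?_)
  · rw [← top_le_iff, ← hBspan]
    refine Submodule.span_mono (Set.image_mono (Finset.coe_subset.2 ?_))
    exact Finset.subset_erase.2 ⟨hBW, hwB⟩
  · by_cases hcb : c b = 0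
    · simp [hcb]
    refine S.smul_mem _ (ih _ (Finset.erase_ssubset (hBW hb)) ?_)
    rw [← top_le_iff, ← hBspan, Submodule.span_le]
    have hne : ∀ x ∈ W, x ≠ b → v x ∈ Submodule.span ℝ (v '' ↑(W.erase b)) := fun x hx hxb =>
      Submodule.subset_span ⟨x, by simp [hx, hxb], rfl⟩
    rintro _ ⟨x, hx, rfl⟩
    by_cases hxb : x = b
    · subst hxb
      rw [SetLike.mem_coe, ← Submodule.smul_mem_iff _ hcb]
      rw [← Finset.add_sum_erase _ _ hb] at hc
      rw [eq_sub_of_add_eq hc]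
      refine Submodule.sub_mem _ (hne w hwW fun h => hwB (h ▸ hb)) (Submodule.sum_mem _ fun y hy => ?_)
      exact Submodule.smul_mem _ _ (hne y (hBW (Finset.mem_of_mem_erase hy)) (Finset.ne_of_mem_erase hy))
    · exact hne x (hBW hx) hxb

/-- with `X` spanning and generic constants, the polynomials `q_{X∖B}`,
`B ∈ 𝔹(X)`, form a Lagrange basis of `𝒫(X)` with respect to the vertex set `b(𝔹(X))`. -/
theorem statement18
    (n : ℕ) (hn : 1 ≤ n) (ι : Type) [Fintype ι] [DecidableEq ι]
    (v : ι → Fin n → ℝ)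
    (hspan : Submodule.span ℝ (Set.range v) = ⊤)
    (lam : ι → ℝ) (bp : Finset ι → Fin n → ℝ)
    (hgeneric : Generic n v lam bp) :
    (∀ B : Finset ι, IsBasisSet n v B →
      qProd n v lam (Finset.univ \ B) ∈ centralP n v ∧
      MvPolynomial.eval (bp B) (qProd n v lam (Finset.univ \ B)) ≠ 0 ∧
      ∀ B' : Finset ι, IsBasisSet n v B' → B' ≠ B →
        MvPolynomial.eval (bp B') (qProd n v lam (Finset.univ \ B)) = 0) ∧
    LinearIndependent ℝ (fun B : {B : Finset ι // IsBasisSet n v B} =>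
      qProd n v lam (Finset.univ \ (B : Finset ι))) ∧
    Submodule.span ℝ (Set.range fun B : {B : Finset ι // IsBasisSet n v B} =>
      qProd n v lam (Finset.univ \ (B : Finset ι))) = centralP n v := by
  have hA : ∀ B : Finset ι, IsBasisSet n v B →
      qProd n v lam (Finset.univ \ B) ∈ centralP n v ∧
      MvPolynomial.eval (bp B) (qProd n v lam (Finset.univ \ B)) ≠ 0 ∧
      ∀ B' : Finset ι, IsBasisSet n v B' → B' ≠ B →
        MvPolynomial.eval (bp B') (qProd n v lam (Finset.univ \ B)) = 0 := by
    intro B hB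
    refine ⟨?_, ?_, ?_⟩
    · refine aux_expand n v _ (fun a => pLin n (v a)) (fun a => - lam a)
        (fun a => by rw [map_neg, sub_eq_add_neg]) _ _ fun Z' hZ' => ?_
      refine Submodule.subset_span ⟨Z', aux_short n v hZ' ?_, rfl⟩
      simpa using hB.2
    · rw [qProd, map_prod, Finset.prod_ne_zero_iff]
      intro a ha h0
      exact (Finset.mem_sdiff.1 ha).2 ((hgeneric B hB a).1 h0)
    · intro B' hB' hne
      have hns : ¬ B' ⊆ B := by
        intro hsub
        apply hne
        have hc : ∀ B, IsBasisSet n v B → B.card = n := by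
          intro B hB
          have := finrank_span_eq_card hB.1
          rw [show Set.range (fun b : B => v b) = v '' ↑B by ext; simp, hB.2] at this
          simpa using this.symm
        exact Finset.eq_of_subset_of_card_le hsub (by rw [hc B hB, hc B' hB'])
      obtain ⟨x, hx, hxB⟩ := Finset.not_subset.1 hns
      rw [qProd, map_prod]
      exact Finset.prod_eq_zero (i := x) (by simp [hxB]) ((hgeneric B' hB' x).2 hx)
  refine ⟨hA, ?_, le_antisymm ?_ ?_⟩
  · classical
    rw [linearIndependent_iff']
    intro s g hg B hB
    have := congrArg (MvPolynomial.eval (bp B)) hg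
    rw [map_sum, map_zero, Finset.sum_eq_single B] at this
    · rw [MvPolynomial.smul_eval] at this
      exact (mul_eq_zero.1 this).resolve_right (hA B B.2).2.1
    · intro B' _ hne
      rw [MvPolynomial.smul_eval, (hA B' B'.2).2.2 B B.2 (fun h => hne (Subtype.ext h.symm)), mul_zero]
    · exact fun h => absurd hB h
  · rw [Submodule.span_le]
    rintro _ ⟨B, rfl⟩
    exact (hA B B.2).1
  · rw [centralP, Submodule.span_le]
    rintro _ ⟨Z, hZ, rfl⟩
    refine aux_expand n v _ (fun a => pLin n (v a) - C (lam a)) lam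
      (fun a => by ring) _ _ fun Z' hZ' => ?_
    have := aux_key n v lam bp hgeneric (Submodule.span ℝ (Set.range fun B : {B : Finset ι // IsBasisSet n v B} =>
      qProd n v lam (Finset.univ \ (B : Finset ι)))) (fun B hB => Submodule.subset_span ⟨⟨B, hB⟩, rfl⟩)
      (Finset.univ \ Z') (aux_short n v hZ' hZ)
    simpa [qProd] using this
end

section
/- For every finite set Θ ⊂ ℝ^n, the restriction map p ↦ (p(θ))_{θ∈Θ} is a linear bijection from the least space Π(Θ) onto ℝ^Θ; in particular dim Π(Θ) = #Θ. -/
open MvPolynomial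

namespace LeastAux

/-- The moment of the functional `c` against the monomial `α`. -/
noncomputable def mom (n : ℕ) (Θ : Finset (Fin n → ℝ)) (c : (Fin n → ℝ) → ℝ)
    (α : Fin n →₀ ℕ) : ℝ :=
  ∑ θ ∈ Θ, c θ * α.prod fun i e => θ i ^ e

/-- Unnormalised degree `j` term of the exponential sum. -/
noncomputable def F (n : ℕ) (Θ : Finset (Fin n → ℝ)) (c : (Fin n → ℝ) → ℝ) (j : ℕ) :
    MvPolynomial (Fin n) ℝ :=
  ∑ θ ∈ Θ, c θ • pLin n θ ^ j

lemma coeff_pLin_pow (n : ℕ) (θ : Fin n → ℝ) (j : ℕ) (α : Fin n →₀ ℕ) :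
    coeff α (pLin n θ ^ j) =
      if α.degree = j then (α.multinomial : ℝ) * α.prod (fun i e => θ i ^ e) else 0 := by
  have h := coeff_linearCombination_X_pow_of_fintype θ α j
  have e : pLin n θ = ∑ r, θ r • (X r : MvPolynomial (Fin n) ℝ) := by
    simp [pLin, MvPolynomial.smul_eq_C_mul]
  rw [e, h]
  rfl

lemma coeff_F (n : ℕ) (Θ : Finset (Fin n → ℝ)) (c : (Fin n → ℝ) → ℝ) (j : ℕ)
    (α : Fin n →₀ ℕ) :
    coeff α (F n Θ c j) =
      if α.degree = j then (α.multinomial : ℝ) * mom n Θ c α else 0 := by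
  simp only [F, mom, coeff_sum, coeff_smul, coeff_pLin_pow]
  split_ifs
  · rw [Finset.mul_sum]
    exact Finset.sum_congr rfl fun _ _ => by simp only [smul_eq_mul]; ring
  · simp

lemma mult_pos {n : ℕ} (α : Fin n →₀ ℕ) : (0 : ℝ) < α.multinomial := by
  rw [Finsupp.multinomial_eq]
  exact_mod_cast Nat.multinomial_pos _ _

lemma mom_eq_zero {n : ℕ} {Θ : Finset (Fin n → ℝ)} {c : (Fin n → ℝ) → ℝ} {α : Fin n →₀ ℕ}
    (h : F n Θ c α.degree = 0) : mom n Θ c α = 0 := by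
  have := coeff_F n Θ c α.degree α
  rw [h, if_pos rfl, coeff_zero] at this
  exact (mul_eq_zero.1 this.symm).resolve_left (mult_pos α).ne'

lemma functional_eq (n : ℕ) (Θ : Finset (Fin n → ℝ)) (c : (Fin n → ℝ) → ℝ)
    (p : MvPolynomial (Fin n) ℝ) :
    ∑ θ ∈ Θ, c θ * eval θ p = ∑ α ∈ p.support, coeff α p * mom n Θ c α := by
  simp only [eval_eq, mom, Finset.mul_sum]
  rw [Finset.sum_comm]
  refine Finset.sum_congr rfl fun α _ => Finset.sum_congr rfl fun θ _ => ?_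
  simp only [Finsupp.prod]
  ring

/-- The key positivity. -/
lemma key_pos {n : ℕ} {Θ : Finset (Fin n → ℝ)} {c : (Fin n → ℝ) → ℝ}
    {p : MvPolynomial (Fin n) ℝ} {j : ℕ} (hdeg : p.totalDegree ≤ j)
    (hlow : ∀ i < j, F n Θ c i = 0) (htop : homogeneousComponent j p = F n Θ c j)
    (hne : F n Θ c j ≠ 0) : 0 < ∑ θ ∈ Θ, c θ * eval θ p := by
  rw [functional_eq]
  have hco : ∀ α : Fin n →₀ ℕ, α.degree = j → coeff α p = α.multinomial * mom n Θ c α := by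
    intro α hα
    have := congrArg (coeff α) htop
    rwa [coeff_homogeneousComponent, coeff_F, if_pos hα, if_pos hα] at this
  apply Finset.sum_pos'
  · intro α hα
    have hle : α.degree ≤ j := (le_totalDegree hα).trans hdeg
    rcases hle.lt_or_eq with h | h
    · rw [mom_eq_zero (hlow _ h)]; simp
    · rw [hco α h, mul_assoc]
      exact mul_nonneg (mult_pos α).le (mul_self_nonneg _)
  · obtain ⟨α, hα⟩ := MvPolynomial.ne_zero_iff.1 hne
    rw [coeff_F] at hα
    split_ifs at hα with h
    · have hm : mom n Θ c α ≠ 0 := (mul_ne_zero_iff.1 hα).2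
      refine ⟨α, ?_, ?_⟩
      · rw [mem_support_iff, hco α h]; exact hα
      · rw [hco α h, mul_assoc]
        exact mul_pos (mult_pos α) (mul_self_pos.2 hm)
    · exact absurd rfl hα

lemma comp_F (n : ℕ) (Θ : Finset (Fin n → ℝ)) (c : (Fin n → ℝ) → ℝ) (i j : ℕ) :
    homogeneousComponent i (F n Θ c j) = if i = j then F n Θ c j else 0 := by
  ext α
  rw [coeff_homogeneousComponent, coeff_F]
  split_ifs <;> simp_all [coeff_F]

lemma F_smul (n : ℕ) (Θ : Finset (Fin n → ℝ)) (c : (Fin n → ℝ) → ℝ) (a : ℝ) (j : ℕ) :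
    F n Θ (fun θ => a * c θ) j = a • F n Θ c j := by
  simp [F, Finset.smul_sum, smul_smul]

lemma F_add (n : ℕ) (Θ : Finset (Fin n → ℝ)) (c d : (Fin n → ℝ) → ℝ) (j : ℕ) :
    F n Θ (fun θ => c θ + d θ) j = F n Θ c j + F n Θ d j := by
  simp [F, add_smul, Finset.sum_add_distrib]

lemma F_zero (n : ℕ) (Θ : Finset (Fin n → ℝ)) (j : ℕ) : F n Θ (fun _ => 0) j = 0 := by
  simp [F]

lemma component_mem {n : ℕ} {Θ : Finset (Fin n → ℝ)} {p : MvPolynomial (Fin n) ℝ}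
    (hp : p ∈ leastSpace n Θ) (j : ℕ) :
    ∃ c, homogeneousComponent j p = F n Θ c j ∧ ∀ i < j, F n Θ c i = 0 := by
  unfold leastSpace at hp
  induction hp using Submodule.span_induction with
  | mem f hf =>
    obtain ⟨c, J, rfl, -, h0⟩ := hf
    by_cases h : j = J
    · subst h
      refine ⟨fun θ => (Nat.factorial j : ℝ)⁻¹ * c θ, ?_, fun i hi => ?_⟩
      · rw [F_smul, map_smul]
        congr 1
        have := comp_F n Θ c j j
        rwa [if_pos rfl] at this
      · rw [F_smul, show F n Θ c i = 0 from h0 i hi, smul_zero]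
    · refine ⟨fun _ => 0, ?_, fun i _ => F_zero _ _ _⟩
      rw [F_zero, map_smul]
      have := comp_F n Θ c j J
      rw [if_neg h] at this
      rw [show homogeneousComponent j (∑ θ ∈ Θ, c θ • pLin n θ ^ J) = 0 from this, smul_zero]
  | zero => exact ⟨fun _ => 0, by simp [F_zero], fun i _ => F_zero _ _ _⟩
  | add x y _ _ hx hy =>
    obtain ⟨c, hc, hc0⟩ := hx
    obtain ⟨d, hd, hd0⟩ := hy
    exact ⟨fun θ => c θ + d θ, by rw [map_add, hc, hd, F_add],
      fun i hi => by rw [F_add, hc0 i hi, hd0 i hi, add_zero]⟩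
  | smul a x _ hx =>
    obtain ⟨c, hc, hc0⟩ := hx
    exact ⟨fun θ => a * c θ, by rw [map_smul, hc, F_smul],
      fun i hi => by rw [F_smul, hc0 i hi, smul_zero]⟩

lemma top_ne_zero {n : ℕ} {p : MvPolynomial (Fin n) ℝ} (hp : p ≠ 0) :
    homogeneousComponent p.totalDegree p ≠ 0 := by
  obtain ⟨α, hα, h⟩ := Finset.exists_mem_eq_sup p.support
    (by rwa [Finset.nonempty_iff_ne_empty, ne_eq, support_eq_empty])
    (fun s : Fin n →₀ ℕ => s.sum fun _ e => e)
  intro h0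
  have h1 := congrArg (coeff α) h0
  rw [coeff_homogeneousComponent, if_pos (show α.degree = p.totalDegree from h.symm)] at h1
  exact (mem_support_iff.1 hα) (by simpa using h1)

lemma injective_aux {n : ℕ} {Θ : Finset (Fin n → ℝ)} {p : MvPolynomial (Fin n) ℝ}
    (hp : p ∈ leastSpace n Θ) (h0 : ∀ θ ∈ Θ, eval θ p = 0) : p = 0 := by
  by_contra hne
  obtain ⟨c, hc, hc0⟩ := component_mem hp p.totalDegree
  have := key_pos le_rfl hc0 hc (hc ▸ top_ne_zero hne)
  rw [Finset.sum_eq_zero fun θ hθ => by rw [h0 θ hθ, mul_zero]] at this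
  exact lt_irrefl _ this

lemma separate (n : ℕ) (Θ : Finset (Fin n → ℝ)) (θ₀ : Fin n → ℝ) :
    ∃ p : MvPolynomial (Fin n) ℝ, eval θ₀ p ≠ 0 ∧ ∀ θ ∈ Θ, θ ≠ θ₀ → eval θ p = 0 := by
  classical
  refine ⟨∏ θ ∈ Θ.erase θ₀, ∑ i, (X i - C (θ i)) ^ 2, ?_, fun θ hθ hne => ?_⟩
  · rw [map_prod, Finset.prod_ne_zero_iff]
    intro θ hθ h
    apply Finset.ne_of_mem_erase hθ
    simp only [map_sum, map_pow, map_sub, eval_X, eval_C] at h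
    rw [Finset.sum_eq_zero_iff_of_nonneg fun _ _ => sq_nonneg _] at h
    funext i
    have := h i (Finset.mem_univ i)
    have := pow_eq_zero_iff (two_ne_zero) |>.1 this
    linarith
  · rw [map_prod]
    exact Finset.prod_eq_zero (Finset.mem_erase.2 ⟨hne, hθ⟩) (by simp)

lemma annihilator {n : ℕ} {Θ : Finset (Fin n → ℝ)} {c : (Fin n → ℝ) → ℝ}
    (h : ∀ p ∈ leastSpace n Θ, ∑ θ ∈ Θ, c θ * eval θ p = 0) : ∀ θ ∈ Θ, c θ = 0 := by
  classical
  have hF : ∀ j, F n Θ c j = 0 := by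
    by_contra! hex
    have hJ := Nat.find_spec hex
    have hlow : ∀ i < Nat.find hex, F n Θ c i = 0 := fun i hi => by
      simpa using Nat.find_min hex hi
    generalize Nat.find hex = J at hJ hlow
    have hJ' : (0 : ℝ) < (Nat.factorial J : ℝ)⁻¹ := by positivity
    have hmem : (Nat.factorial J : ℝ)⁻¹ • F n Θ c J ∈ leastSpace n Θ :=
      Submodule.subset_span ⟨c, J, rfl, smul_ne_zero hJ'.ne' hJ, hlow⟩
    have hmem' : F n Θ c J ∈ leastSpace n Θ := by
      have := (leastSpace n Θ).smul_mem (Nat.factorial J : ℝ) hmem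
      rwa [smul_smul, mul_inv_cancel₀ (inv_pos.1 hJ').ne', one_smul] at this
    have hd : (F n Θ c J).totalDegree ≤ J := by
      refine Finset.sup_le fun α hα => ?_
      rw [mem_support_iff, coeff_F] at hα
      have : α.degree = J := by
        by_contra h'
        simp [h'] at hα
      exact this.le
    have := key_pos hd hlow (by rw [comp_F, if_pos rfl]) hJ
    rw [h _ hmem'] at this
    exact lt_irrefl _ this
  intro θ₀ hθ₀
  obtain ⟨p, hp, hp0⟩ := separate n Θ θ₀
  have h1 := functional_eq n Θ c p
  rw [Finset.sum_eq_zero (s := p.support) fun α _ => by rw [mom_eq_zero (hF _), mul_zero],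
    Finset.sum_eq_single_of_mem θ₀ hθ₀ fun θ hθ hne => by rw [hp0 θ hθ hne, mul_zero]] at h1
  exact (mul_eq_zero.1 h1).resolve_right hp

/-- The restriction map as a linear map. -/
noncomputable def res (n : ℕ) (Θ : Finset (Fin n → ℝ)) : leastSpace n Θ →ₗ[ℝ] (Θ → ℝ) where
  toFun p θ := eval (θ : Fin n → ℝ) (p : MvPolynomial (Fin n) ℝ)
  map_add' p q := by ext; simp
  map_smul' a p := by ext; simp [smul_eval]

lemma res_bij (n : ℕ) (Θ : Finset (Fin n → ℝ)) : Function.Bijective (res n Θ) := by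
  classical
  constructor
  · rw [← LinearMap.ker_eq_bot, LinearMap.ker_eq_bot']
    intro p hp
    exact Subtype.ext (injective_aux p.2 fun θ hθ => congrFun hp ⟨θ, hθ⟩)
  · rw [← LinearMap.range_eq_top]
    by_contra hne
    obtain ⟨f, hf, hle⟩ := Submodule.exists_le_ker_of_lt_top _ (lt_top_iff_ne_top.2 hne)
    apply hf
    let c : (Fin n → ℝ) → ℝ := fun θ => if h : θ ∈ Θ then f (Pi.single ⟨θ, h⟩ 1) else 0
    have hfc : ∀ g : Θ → ℝ, f g = ∑ θ : Θ, c θ * g θ := by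
      intro g
      rw [LinearMap.pi_apply_eq_sum_univ f g]
      refine Finset.sum_congr rfl fun θ _ => ?_
      simp only [c, θ.2, dif_pos, smul_eq_mul]
      rw [mul_comm]
      congr 2
      ext i
      simp [Pi.single_apply, eq_comm]
    have hc : ∀ θ ∈ Θ, c θ = 0 := by
      apply annihilator
      intro p hp
      have h1 : f (res n Θ ⟨p, hp⟩) = 0 := hle (LinearMap.mem_range_self _ _)
      rw [hfc] at h1
      rw [← Finset.sum_coe_sort]
      exact h1
    refine LinearMap.ext fun g => ?_
    rw [hfc, LinearMap.zero_apply]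
    exact Finset.sum_eq_zero fun θ _ => by rw [hc θ θ.2, zero_mul]

end LeastAux

/-- for every finite `Θ ⊂ ℝ^n`, restriction to `Θ` is a linear bijection
from the least space `Π(Θ)` onto `ℝ^Θ`; in particular `dim Π(Θ) = #Θ`. -/
theorem statement19
    (n : ℕ) (hn : 1 ≤ n) (Θ : Finset (Fin n → ℝ)) :
    Function.Bijective (fun (p : leastSpace n Θ) (θ : Θ) =>
      MvPolynomial.eval (θ : Fin n → ℝ) (p : MvPolynomial (Fin n) ℝ)) ∧
    Module.rank ℝ (leastSpace n Θ) = (Θ.card : Cardinal) := by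
  have h := LeastAux.res_bij n Θ
  refine ⟨h, ?_⟩
  rw [(LinearEquiv.ofBijective _ h).rank_eq, rank_fun']
  simp
end
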